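/- There exists an absolute constant c > 0 with the following property. Let f be a force with (c/(α^{5/2} β)) ‖f‖_{H¹_α} < β. If (U₁, N₁, P₁) and (U₂, N₂, P₂) are two classical stationary solutions of the damped Navier–Stokes–Bardina equations with force f, then U₁ = U₂ (the stationary solution is unique). -/

import Mathlib

open MeasureTheory Set

noncomputable section

abbrev V3 : Type := Fin 3 → ℝ

def pd (j : Fin 3) (g : V3 → Fin 3 → ℝ) : V3 → Fin 3 → ℝ :=
  fun x => fderiv ℝ g x (Pi.single j 1)

def pdS (j : Fin 3) (g : V3 → ℝ) : V3 → ℝ :=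
  fun x => fderiv ℝ g x (Pi.single j 1)

def L2sq (g : V3 → Fin 3 → ℝ) : ℝ := ∫ x : V3, ∑ i, (g x i)^2
def H1sq (g : V3 → Fin 3 → ℝ) : ℝ := ∫ x : V3, ∑ i, ∑ j, (pd j g x i)^2
def H2sq (g : V3 → Fin 3 → ℝ) : ℝ := ∫ x : V3, ∑ i, ∑ j, ∑ k, (pd k (pd j g) x i)^2
def H1aSq (α : ℝ) (g : V3 → Fin 3 → ℝ) : ℝ := L2sq g + α^2 * H1sq g

def IsSchwartz {F : Type*} [NormedAddCommGroup F] [NormedSpace ℝ F] (g : V3 → F) : Prop :=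
  ContDiff ℝ (⊤ : ℕ∞) g ∧ ∀ (k n : ℕ), ∃ C : ℝ, ∀ x : V3, ‖x‖ ^ k * ‖iteratedFDeriv ℝ n g x‖ ≤ C

def IsForce (f : V3 → Fin 3 → ℝ) : Prop :=
  IsSchwartz f ∧ ∀ x, (∑ j, pd j f x j) = 0

def SchwartzLocBdd {F : Type*} [NormedAddCommGroup F] [NormedSpace ℝ F]
    (g : ℝ → V3 → F) : Prop :=
  ContDiffOn ℝ (⊤ : ℕ∞) (fun q : ℝ × V3 => g q.1 q.2) (Set.Ici (0:ℝ) ×ˢ Set.univ) ∧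
  ∀ T > (0:ℝ), ∀ (k n : ℕ), ∃ C : ℝ, ∀ t ∈ Set.Icc (0:ℝ) T, ∀ x : V3,
    ‖x‖ ^ k * ‖iteratedFDeriv ℝ n (g t) x‖ ≤ C

structure ClassicalSolution (α β ν : ℝ) (u₀ f : V3 → Fin 3 → ℝ) where
  u : ℝ → V3 → Fin 3 → ℝ
  N : ℝ → V3 → Fin 3 → ℝ
  p : ℝ → V3 → ℝ
  reg_u : SchwartzLocBdd u
  reg_N : SchwartzLocBdd N
  reg_p : SchwartzLocBdd p
  divFree : ∀ t ≥ (0:ℝ), ∀ x, (∑ j, pd j (u t) x j) = 0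
  filter : ∀ t ≥ (0:ℝ), ∀ x i, -α^2 * (∑ j, pd j (pd j (N t)) x i) + N t x i
      = ∑ j, u t x j * pd j (u t) x i
  momentum : ∀ t ≥ (0:ℝ), ∀ x i,
      derivWithin (fun s => u s x i) (Set.Ici (0:ℝ)) t + N t x i
        - ν * (∑ j, pd j (pd j (u t)) x i) + pdS i (p t) x
      = f x i - β * u t x i
  init : ∀ x, u 0 x = u₀ x


structure StationarySolution (α β ν : ℝ) (f : V3 → Fin 3 → ℝ) where
  U : V3 → Fin 3 → ℝ
  N : V3 → Fin 3 → ℝ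
  P : V3 → ℝ
  schwartz_U : IsSchwartz U
  schwartz_N : IsSchwartz N
  schwartz_P : IsSchwartz P
  divFree : ∀ x, (∑ j, pd j U x j) = 0
  filter : ∀ x i, -α^2 * (∑ j, pd j (pd j N) x i) + N x i = ∑ j, U x j * pd j U x i
  momentum : ∀ x i, -ν * (∑ j, pd j (pd j U) x i) + N x i + pdS i P x
      = f x i - β * U x i

open scoped SchwartzMap LineDeriv ENNReal

section GagliardoNirenberg

open Filter Topology

/-- A `C¹` function on the line vanishing at `-∞` is bounded by the `L¹` norm of its derivative. -/
theorem enorm_le_lintegral_deriv_of_tendsto {f : ℝ → ℝ} (hf : ContDiff ℝ 1 f)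
    (h0 : Tendsto f atBot (𝓝 0)) (x : ℝ) : ‖f x‖ₑ ≤ ∫⁻ y, ‖deriv f y‖ₑ := by
  by_cases hfin : ∫⁻ y, ‖deriv f y‖ₑ = ∞
  · simp [hfin]
  have hint : Integrable (deriv f) :=
    ⟨(hf.continuous_deriv le_rfl).aestronglyMeasurable, lt_top_iff_ne_top.2 hfin⟩
  have h := integral_Iic_of_hasDerivAt_of_tendsto' (a := x)
    (fun y _ => (hf.differentiable one_ne_zero y).hasDerivAt) hint.integrableOn h0
  rw [sub_zero] at h
  rw [← h]
  exact (enorm_integral_le_lintegral_enorm _).trans (lintegral_mono' Measure.restrict_le_self le_rfl)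

/-- The Gagliardo-Nirenberg-Sobolev inequality for `C¹` functions on `ℝ³` vanishing at infinity. -/
theorem lintegral_rpow_le_of_tendsto_cocompact {u : V3 → ℝ} (hu : ContDiff ℝ 1 u)
    (h0 : Tendsto u (cocompact V3) (𝓝 0)) :
    ∫⁻ x, ‖u x‖ₑ ^ (3 / 2 : ℝ) ≤ (∫⁻ x, ‖fderiv ℝ u x‖ₑ) ^ (3 / 2 : ℝ) := by
  have hp : Real.HolderConjugate (Fintype.card (Fin 3)) (3 / 2 : ℝ) := by
    rw [Real.holderConjugate_iff]; norm_num
  refine le_trans (lintegral_mono fun x => ?_)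
    (lintegral_prod_lintegral_pow_le (fun _ : Fin 3 => (volume : Measure ℝ)) hp
      (f := fun x => ‖fderiv ℝ u x‖ₑ) (by fun_prop))
  have hline : ∀ i : Fin 3, ‖u x‖ₑ ≤ ∫⁻ t, ‖fderiv ℝ u (Function.update x i t)‖ₑ := by
    intro i
    have hcont : ContDiff ℝ 1 (u ∘ Function.update x i) :=
      hu.comp (by convert! contDiff_update 1 x i)
    have hlim : Tendsto (u ∘ Function.update x i) atBot (𝓝 0) :=
      h0.comp ((isClosedEmbedding_update x i).tendsto_cocompact.mono_left
        (by rw [cocompact_eq_atBot_atTop]; exact le_sup_left))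
    have h := enorm_le_lintegral_deriv_of_tendsto hcont hlim (x i)
    refine (le_trans (by simp) h).trans (lintegral_mono fun y => ?_)
    calc ‖deriv (u ∘ Function.update x i) y‖ₑ
        = ‖fderiv ℝ u (Function.update x i y) (deriv (Function.update x i) y)‖ₑ := by
          rw [fderiv_comp_deriv _ (hu.differentiable one_ne_zero).differentiableAt
            (hasDerivAt_update x i y).differentiableAt]
      _ ≤ ‖fderiv ℝ u (Function.update x i y)‖ₑ * ‖deriv (Function.update x i) y‖ₑ :=
          ContinuousLinearMap.le_opENorm _ _
      _ ≤ _ := by simp [deriv_update, Pi.enorm_single]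
  calc ‖u x‖ₑ ^ (3 / 2 : ℝ)
      = ∏ _i : Fin 3, ‖u x‖ₑ ^ ((1 : ℝ) / ((Fintype.card (Fin 3) : ℝ) - 1)) := by
        rw [Finset.prod_const, ← ENNReal.rpow_mul_natCast]
        norm_num
    _ ≤ _ := by
        gcongr with i
        · norm_num
        · exact hline i

end GagliardoNirenberg

section SchwartzCalculus

/-- The partial derivative `∂ⱼ` on real-valued Schwartz functions. -/
def partialD (j : Fin 3) : 𝓢(V3, ℝ) →ₗ[ℝ] 𝓢(V3, ℝ) :=
  (LineDeriv.lineDerivOpCLM ℝ 𝓢(V3, ℝ) (Pi.single j (1 : ℝ) : V3)).toLinearMap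

/-- The pointwise product of real-valued Schwartz functions. -/
def schwartzMul (a b : 𝓢(V3, ℝ)) : 𝓢(V3, ℝ) :=
  SchwartzMap.pairing (ContinuousLinearMap.mul ℝ ℝ) a b

/-- The `L²` pairing of real-valued Schwartz functions. -/
def pairL2 : 𝓢(V3, ℝ) →ₗ[ℝ] 𝓢(V3, ℝ) →ₗ[ℝ] ℝ :=
  LinearMap.mk₂ ℝ (fun a b => SchwartzMap.integralCLM ℝ volume (schwartzMul a b))
    (by intros; rw [← map_add]; congr 1; ext; simp [schwartzMul])
    (by intros; rw [← map_smul]; congr 1; ext; simp [schwartzMul])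
    (by intros; rw [← map_add]; congr 1; ext; simp [schwartzMul])
    (by intros; rw [← map_smul]; congr 1; ext; simp [schwartzMul])

@[simp] theorem schwartzMul_apply (a b : 𝓢(V3, ℝ)) (x : V3) :
    schwartzMul a b x = a x * b x := rfl

theorem partialD_apply (j : Fin 3) (a : 𝓢(V3, ℝ)) (x : V3) :
    partialD j a x = fderiv ℝ a x (Pi.single j 1) := rfl

theorem pairL2_apply (a b : 𝓢(V3, ℝ)) : pairL2 a b = ∫ x, a x * b x := rfl

theorem pairL2_comm (a b : 𝓢(V3, ℝ)) : pairL2 a b = pairL2 b a := by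
  simp only [pairL2_apply, mul_comm]

theorem pairL2_self_nonneg (a : 𝓢(V3, ℝ)) : 0 ≤ pairL2 a a :=
  integral_nonneg fun x => mul_self_nonneg (a x)

theorem pairL2_sq_le (a b : 𝓢(V3, ℝ)) : pairL2 a b ^ 2 ≤ pairL2 a a * pairL2 b b := by
  rw [sq]
  nth_rewrite 2 [pairL2_comm]
  exact LinearMap.BilinForm.apply_mul_apply_le_of_forall_zero_le pairL2 pairL2_self_nonneg a b

theorem eq_zero_of_pairL2_self {a : 𝓢(V3, ℝ)} (h : pairL2 a a = 0) : a = 0 := by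
  have hc : Continuous fun x => a x * a x := by fun_prop
  have hi : Integrable fun x => a x * a x := (schwartzMul a a).integrable
  rw [pairL2_apply, integral_eq_zero_iff_of_nonneg (fun x => mul_self_nonneg (a x)) hi,
    hc.ae_eq_iff_eq volume continuous_zero] at h
  ext x
  simpa using congrFun h x

theorem pairL2_partialD_left (j : Fin 3) (a b : 𝓢(V3, ℝ)) :
    pairL2 (partialD j a) b = - pairL2 a (partialD j b) := by
  have h := SchwartzMap.integral_mul_lineDerivOp_right_eq_neg_left (μ := volume) a b
    (Pi.single j (1 : ℝ) : V3)
  rw [pairL2_apply, pairL2_apply]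
  exact (neg_eq_iff_eq_neg.2 h).symm ▸ rfl

theorem partialD_comm (j k : Fin 3) (a : 𝓢(V3, ℝ)) :
    partialD j (partialD k a) = partialD k (partialD j a) := by
  ext x
  have hd : DifferentiableAt ℝ (fderiv ℝ a) x :=
    ((a.smooth 2).fderiv_right (m := 1) le_rfl).differentiable one_ne_zero x
  have key : ∀ v w : V3, fderiv ℝ (fun y => fderiv ℝ a y v) x w = fderiv ℝ (fderiv ℝ a) x w v := by
    intro v w
    rw [fderiv_clm_apply hd (differentiableAt_const v)]
    simp
  change fderiv ℝ (fun y => fderiv ℝ a y _) x _ = fderiv ℝ (fun y => fderiv ℝ a y _) x _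
  rw [key, key]
  exact second_derivative_symmetric (fun y => a.hasFDerivAt y) hd.hasFDerivAt _ _

theorem partialD_schwartzMul (j : Fin 3) (a b : 𝓢(V3, ℝ)) :
    partialD j (schwartzMul a b) = schwartzMul (partialD j a) b + schwartzMul a (partialD j b) := by
  ext x
  change fderiv ℝ (fun y => a y * b y) x _ = _
  rw [fderiv_fun_mul a.differentiableAt b.differentiableAt]
  simp [partialD_apply]
  ring

theorem pairL2_schwartzMul_left (a b c : 𝓢(V3, ℝ)) :
    pairL2 (schwartzMul a b) c = pairL2 b (schwartzMul a c) := by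
  simp only [pairL2_apply, schwartzMul_apply]
  congr 1; ext x; ring

/-- The Laplacian on real-valued Schwartz functions. -/
def laplace : 𝓢(V3, ℝ) →ₗ[ℝ] 𝓢(V3, ℝ) := ∑ j, partialD j ∘ₗ partialD j

theorem laplace_apply (a : 𝓢(V3, ℝ)) : laplace a = ∑ j, partialD j (partialD j a) := by
  simp [laplace]

theorem pairL2_laplace_left (a b : 𝓢(V3, ℝ)) :
    pairL2 (laplace a) b = - ∑ j, pairL2 (partialD j a) (partialD j b) := by
  simp [laplace_apply, map_sum, LinearMap.sum_apply, pairL2_partialD_left]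

theorem pairL2_laplace_comm (a b : 𝓢(V3, ℝ)) :
    pairL2 (laplace a) b = pairL2 a (laplace b) := by
  rw [pairL2_comm a, pairL2_laplace_left, pairL2_laplace_left]
  simp only [pairL2_comm]

theorem partialD_laplace (i : Fin 3) (a : 𝓢(V3, ℝ)) :
    partialD i (laplace a) = laplace (partialD i a) := by
  simp only [laplace_apply, map_sum]
  exact Finset.sum_congr rfl fun j _ => by rw [partialD_comm, partialD_comm i j]

end SchwartzCalculus

section Ladyzhenskaya

theorem norm_le_sum_abs_apply_single (L : V3 →L[ℝ] ℝ) : ‖L‖ ≤ ∑ j, |L (Pi.single j 1)| := by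
  refine L.opNorm_le_bound (Finset.sum_nonneg fun j _ => abs_nonneg _) fun x => ?_
  have hx : L x = ∑ j, x j * L (Pi.single j 1) := by
    conv_lhs => rw [pi_eq_sum_univ' x, map_sum]
    simp
  rw [hx, Finset.sum_mul]
  refine (norm_sum_le _ _).trans (Finset.sum_le_sum fun j _ => ?_)
  rw [norm_mul, mul_comm, ← Real.norm_eq_abs]
  gcongr
  exact norm_le_pi_norm x j

theorem sq_integral_abs_mul_le (a b : 𝓢(V3, ℝ)) :
    (∫ x, |a x * b x|) ^ 2 ≤ pairL2 a a * pairL2 b b := by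
  have haa : Integrable fun x => a x * a x := (schwartzMul a a).integrable
  have hbb : Integrable fun x => b x * b x := (schwartzMul b b).integrable
  have hab : Integrable fun x => |a x * b x| := (schwartzMul a b).integrable.abs
  have h : discrim (pairL2 a a) (-2 * ∫ x, |a x * b x|) (pairL2 b b) ≤ 0 := by
    refine discrim_le_zero fun t => ?_
    have h0 : 0 ≤ ∫ x, (t * |a x| - |b x|) ^ 2 := integral_nonneg fun x => sq_nonneg _
    have he : ∀ x, (t * |a x| - |b x|) ^ 2
        = t * t * (a x * a x) + -2 * t * |a x * b x| + b x * b x := by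
      intro x
      rw [abs_mul, sub_sq, mul_pow, sq_abs, sq_abs]
      ring
    simp only [he] at h0
    have hsum : Integrable fun x => t * t * (a x * a x) + -2 * t * |a x * b x| :=
      (haa.const_mul _).add (hab.const_mul _)
    rw [integral_add hsum hbb,
      integral_add (haa.const_mul _) (hab.const_mul _), integral_const_mul, integral_const_mul] at h0
    simp only [pairL2_apply]
    linarith
  rw [discrim] at h
  linarith

theorem le_of_sq_le_of_sq_le {A S G : ℝ} (hA : 0 ≤ A) (hG : 0 ≤ G) (h₁ : A ^ 2 ≤ (4 * S) ^ 3)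
    (h₂ : S ^ 2 ≤ 3 * (A * G)) : A ≤ 48 ^ 3 * G ^ 3 := by
  rcases hA.eq_or_lt with h | h
  · rw [← h]; positivity
  · refine le_of_mul_le_mul_left ?_ (pow_pos h 3)
    calc A ^ 3 * A = (A ^ 2) ^ 2 := by ring
      _ ≤ ((4 * S) ^ 3) ^ 2 := by gcongr
      _ = 4096 * (S ^ 2) ^ 3 := by ring
      _ ≤ 4096 * (3 * (A * G)) ^ 3 := by gcongr
      _ = A ^ 3 * (48 ^ 3 * G ^ 3) := by ring

/-- The homogeneous Sobolev inequality `‖w‖_{L⁶} ≤ C ‖∇w‖_{L²}` on `ℝ³`. -/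
theorem integral_pow_six_le (w : 𝓢(V3, ℝ)) :
    ∫ x, w x ^ 6 ≤ 48 ^ 3 * (∑ j, pairL2 (partialD j w) (partialD j w)) ^ 3 := by
  set w2 := schwartzMul w w with hw2
  set w3 := schwartzMul w w2 with hw3
  set w4 := schwartzMul w2 w2 with hw4
  set X : Fin 3 → ℝ := fun j => ∫ x, |w3 x * partialD j w x| with hX
  set G := ∑ j, pairL2 (partialD j w) (partialD j w) with hG
  have hX0 : ∀ j, 0 ≤ X j := fun j => integral_nonneg fun x => abs_nonneg _
  have hG0 : 0 ≤ G := Finset.sum_nonneg fun j _ => pairL2_self_nonneg _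
  set A := ∫ x, w x ^ 6 with hA
  have hA3 : A = pairL2 w3 w3 := by
    simp only [hA, pairL2_apply, hw3, hw2, schwartzMul_apply]
    congr 1; ext x; ring
  have hA0 : 0 ≤ A := hA3 ▸ pairL2_self_nonneg w3
  have hgrad : ∀ x, ‖fderiv ℝ w4 x‖ ≤ ∑ j, 4 * |w3 x * partialD j w x| := by
    intro x
    refine (norm_le_sum_abs_apply_single _).trans (le_of_eq (Finset.sum_congr rfl fun j _ => ?_))
    have hd : fderiv ℝ w4 x (Pi.single j 1) = 4 * (w3 x * partialD j w x) := by
      rw [← partialD_apply, hw4, partialD_schwartzMul, hw2, partialD_schwartzMul]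
      simp [hw3, hw2]
      ring
    rw [hd, abs_mul]
    norm_num
  have hGN := lintegral_rpow_le_of_tendsto_cocompact (w4.smooth 1) (zero_at_infty w4)
  have hlhs : ∫⁻ x, ‖w4 x‖ₑ ^ (3 / 2 : ℝ) = ENNReal.ofReal A := by
    rw [hA, ofReal_integral_eq_lintegral_ofReal]
    · congr 1; ext x
      rw [← ofReal_norm, ENNReal.ofReal_rpow_of_nonneg (norm_nonneg _) (by norm_num)]
      congr 1
      have h4 : ‖w4 x‖ = |w x| ^ (4 : ℝ) := by
        rw [hw4, hw2]
        simp only [schwartzMul_apply, Real.norm_eq_abs, abs_mul]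
        norm_cast; ring
      rw [h4, ← Real.rpow_mul (abs_nonneg _)]
      norm_num
      rw [Even.pow_abs (by decide)]
    · refine (schwartzMul w3 w3).integrable.congr (Filter.Eventually.of_forall fun x => ?_)
      simp only [hw3, hw2, schwartzMul_apply]; ring
    · exact Filter.Eventually.of_forall fun x => by positivity
  have hrhs : ∫⁻ x, ‖fderiv ℝ w4 x‖ₑ ≤ ENNReal.ofReal (4 * ∑ j, X j) := by
    have hi : ∀ j, Integrable fun x => 4 * |w3 x * partialD j w x| := fun j =>
      (schwartzMul w3 (partialD j w)).integrable.abs.const_mul 4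
    have he : 4 * ∑ j, X j = ∫ x, ∑ j, 4 * |w3 x * partialD j w x| := by
      rw [integral_finsetSum _ fun j _ => hi j, Finset.mul_sum]
      exact Finset.sum_congr rfl fun j _ => (integral_const_mul _ _).symm
    rw [he, ofReal_integral_eq_lintegral_ofReal (integrable_finsetSum _ fun j _ => hi j)
      (Filter.Eventually.of_forall fun x => Finset.sum_nonneg fun j _ => by positivity)]
    refine lintegral_mono fun x => ?_
    rw [← ofReal_norm]
    exact ENNReal.ofReal_le_ofReal (hgrad x)
  have hS0 : 0 ≤ 4 * ∑ j, X j := mul_nonneg (by norm_num) (Finset.sum_nonneg fun j _ => hX0 j)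
  have hAS : A ≤ (4 * ∑ j, X j) ^ (3 / 2 : ℝ) := by
    rw [hlhs] at hGN
    have h := hGN.trans (ENNReal.rpow_le_rpow hrhs (by norm_num))
    rw [ENNReal.ofReal_rpow_of_nonneg hS0 (by norm_num)] at h
    exact (ENNReal.ofReal_le_ofReal_iff (by positivity)).1 h
  have hAsq : A ^ 2 ≤ (4 * ∑ j, X j) ^ 3 := by
    calc A ^ 2 ≤ ((4 * ∑ j, X j) ^ (3 / 2 : ℝ)) ^ 2 := by gcongr
      _ = _ := by
        rw [← Real.rpow_mul_natCast hS0, ← Real.rpow_natCast]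
        norm_num
  have hXsq : (∑ j, X j) ^ 2 ≤ 3 * (A * G) := by
    have h1 : (∑ j, X j) ^ 2 ≤ 3 * ∑ j, X j ^ 2 := by
      simpa using sq_sum_le_card_mul_sum_sq (s := Finset.univ) (f := X)
    have h2 : ∑ j, X j ^ 2 ≤ A * G := by
      rw [hG, Finset.mul_sum]
      exact Finset.sum_le_sum fun j _ => hA3 ▸ sq_integral_abs_mul_le _ _
    linarith
  exact le_of_sq_le_of_sq_le hA0 hG0 hAsq hXsq

theorem le_of_sq_le_mul_pow {α L B G E : ℝ} (hG : 0 ≤ G) (hE : 0 ≤ E)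
    (hBE : B ≤ E) (hGE : α ^ 2 * G ≤ E) (h : L ^ 2 ≤ B * (48 ^ 3 * G ^ 3)) :
    α ^ 3 * L ≤ 400 * E ^ 2 := by
  refine le_of_sq_le_sq ?_ (by positivity)
  calc (α ^ 3 * L) ^ 2 = α ^ 6 * L ^ 2 := by ring
    _ ≤ α ^ 6 * (B * (48 ^ 3 * G ^ 3)) := by gcongr
    _ = 48 ^ 3 * (B * (α ^ 2 * G) ^ 3) := by ring
    _ ≤ 48 ^ 3 * (E * E ^ 3) := by gcongr
    _ ≤ (400 * E ^ 2) ^ 2 := by nlinarith [pow_nonneg hE 4]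

/-- The square of the `H¹_α` norm of a real-valued Schwartz function. -/
def energy (α : ℝ) (w : 𝓢(V3, ℝ)) : ℝ :=
  pairL2 w w + α ^ 2 * ∑ j, pairL2 (partialD j w) (partialD j w)

theorem energy_nonneg (α : ℝ) (w : 𝓢(V3, ℝ)) : 0 ≤ energy α w :=
  add_nonneg (pairL2_self_nonneg w)
    (mul_nonneg (sq_nonneg α) (Finset.sum_nonneg fun _ _ => pairL2_self_nonneg _))

/-- The Ladyzhenskaya inequality, in terms of the `H¹_α` norm. -/
theorem pairL2_sq_sq_le (α : ℝ) (w : 𝓢(V3, ℝ)) :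
    α ^ 3 * pairL2 (schwartzMul w w) (schwartzMul w w) ≤ 400 * energy α w ^ 2 := by
  set G := ∑ j, pairL2 (partialD j w) (partialD j w) with hG
  have hG0 : 0 ≤ G := Finset.sum_nonneg fun j _ => pairL2_self_nonneg _
  have h0 := pairL2_self_nonneg w
  have hE : energy α w = pairL2 w w + α ^ 2 * G := rfl
  have h6 : pairL2 (schwartzMul w (schwartzMul w w)) (schwartzMul w (schwartzMul w w))
      ≤ 48 ^ 3 * G ^ 3 := by
    refine le_trans (le_of_eq ?_) (integral_pow_six_le w)
    simp only [pairL2_apply, schwartzMul_apply]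
    congr 1; ext x; ring
  have hcs : pairL2 (schwartzMul w w) (schwartzMul w w) ^ 2 ≤ pairL2 w w * (48 ^ 3 * G ^ 3) := by
    rw [pairL2_schwartzMul_left]
    exact (pairL2_sq_le _ _).trans (by gcongr)
  have hE0 := energy_nonneg α w
  refine le_of_sq_le_mul_pow hG0 hE0 ?_ ?_ hcs
  · rw [hE]; linarith [mul_nonneg (sq_nonneg α) hG0]
  · rw [hE]; linarith

end Ladyzhenskaya

section EnergyEstimates

/-- The polarization of `energy`. -/
def energyForm (α : ℝ) (a b : 𝓢(V3, ℝ)) : ℝ :=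
  pairL2 a b + α ^ 2 * ∑ j, pairL2 (partialD j a) (partialD j b)

theorem pairL2_helmholtz (α : ℝ) (a b : 𝓢(V3, ℝ)) :
    pairL2 a (b - α ^ 2 • laplace b) = energyForm α a b := by
  rw [map_sub, map_smul, ← pairL2_laplace_comm, pairL2_laplace_left, energyForm, smul_eq_mul]
  ring

theorem pairL2_helmholtz_comm (α : ℝ) (a b : 𝓢(V3, ℝ)) :
    pairL2 a (b - α ^ 2 • laplace b) = pairL2 (a - α ^ 2 • laplace a) b := by
  simp [pairL2_laplace_comm]

theorem two_mul_energyForm_le (α β : ℝ) (a b : 𝓢(V3, ℝ)) :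
    2 * β * energyForm α a b ≤ energy α a + β ^ 2 * energy α b := by
  have key : ∀ p q : 𝓢(V3, ℝ), 2 * β * pairL2 p q ≤ pairL2 p p + β ^ 2 * pairL2 q q := by
    intro p q
    have h := pairL2_self_nonneg (p - β • q)
    simp only [map_sub, map_smul, LinearMap.sub_apply, LinearMap.smul_apply, smul_eq_mul,
      pairL2_comm q p] at h
    linarith
  have hs : 2 * β * ∑ j, pairL2 (partialD j a) (partialD j b)
      ≤ ∑ j, pairL2 (partialD j a) (partialD j a)
        + β ^ 2 * ∑ j, pairL2 (partialD j b) (partialD j b) := by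
    rw [Finset.mul_sum, Finset.mul_sum, ← Finset.sum_add_distrib]
    exact Finset.sum_le_sum fun j _ => key _ _
  have := mul_le_mul_of_nonneg_left hs (sq_nonneg α)
  have := key a b
  rw [energyForm, energy, energy]
  linarith

/-- The convective term `(a · ∇) b`, in the `i`-th component. -/
def convect (a b : Fin 3 → 𝓢(V3, ℝ)) (i : Fin 3) : 𝓢(V3, ℝ) :=
  ∑ j, schwartzMul (a j) (partialD j (b i))

theorem sum_pairL2_convect_self {a : Fin 3 → 𝓢(V3, ℝ)} (ha : ∑ j, partialD j (a j) = 0)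
    (b : Fin 3 → 𝓢(V3, ℝ)) : ∑ i, pairL2 (convect a b i) (b i) = 0 := by
  refine Finset.sum_eq_zero fun i _ => ?_
  have key : ∀ j, 2 * pairL2 (schwartzMul (a j) (partialD j (b i))) (b i)
      = - pairL2 (schwartzMul (b i) (b i)) (partialD j (a j)) := by
    intro j
    have h1 : pairL2 (schwartzMul (b i) (b i)) (partialD j (a j))
        = pairL2 (b i) (schwartzMul (partialD j (a j)) (b i)) := by
      simp only [pairL2_apply, schwartzMul_apply]
      congr 1; ext x; ring
    have h2 : pairL2 (b i) (schwartzMul (a j) (partialD j (b i)))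
        = pairL2 (partialD j (b i)) (schwartzMul (a j) (b i)) := by
      simp only [pairL2_apply, schwartzMul_apply]
      congr 1; ext x; ring
    have h3 := pairL2_partialD_left j (b i) (schwartzMul (a j) (b i))
    rw [partialD_schwartzMul, map_add] at h3
    rw [pairL2_schwartzMul_left, h1]
    linarith
  have hs : 2 * pairL2 (convect a b i) (b i) = 0 := by
    rw [convect, map_sum, LinearMap.sum_apply, Finset.mul_sum, Finset.sum_congr rfl fun j _ => key j,
      Finset.sum_neg_distrib, ← map_sum, ha, map_zero, neg_zero]
  linarith

/-- The `H¹_α` energy estimate for the linearized stationary system with filtered forcing `h`. -/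
theorem energy_estimate {α β ν : ℝ} (hν : 0 ≤ ν) {V M g h : Fin 3 → 𝓢(V3, ℝ)} {Q : 𝓢(V3, ℝ)}
    (hdiv : ∑ j, partialD j (V j) = 0)
    (hfilter : ∀ i, M i - α ^ 2 • laplace (M i) = h i)
    (hmom : ∀ i, -(ν • laplace (V i)) + M i + partialD i Q = g i - β • V i) :
    β * ∑ i, energy α (V i) ≤ ∑ i, energyForm α (g i) (V i) - ∑ i, pairL2 (h i) (V i) := by
  have hpressure : ∑ i, pairL2 (partialD i Q) (V i - α ^ 2 • laplace (V i)) = 0 := by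
    simp only [pairL2_partialD_left, Finset.sum_neg_distrib, ← map_sum, map_sub, map_smul,
      partialD_laplace, Finset.sum_sub_distrib, ← Finset.smul_sum]
    rw [hdiv]
    simp
  have hcomp : ∀ i, β * energy α (V i) ≤ energyForm α (g i) (V i) - pairL2 (h i) (V i)
      - pairL2 (partialD i Q) (V i - α ^ 2 • laplace (V i)) := by
    intro i
    have h1 := congrArg (fun F => pairL2 F (V i - α ^ 2 • laplace (V i))) (hmom i)
    have hM : pairL2 (M i) (V i - α ^ 2 • laplace (V i)) = pairL2 (h i) (V i) := by
      rw [pairL2_helmholtz_comm, hfilter]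
    have hg := pairL2_helmholtz α (g i) (V i)
    have hV : pairL2 (V i) (V i - α ^ 2 • laplace (V i)) = energy α (V i) := pairL2_helmholtz α _ _
    have hL : pairL2 (laplace (V i)) (V i - α ^ 2 • laplace (V i)) ≤ 0 := by
      rw [map_sub, map_smul, pairL2_laplace_left, smul_eq_mul]
      have := mul_nonneg (sq_nonneg α) (pairL2_self_nonneg (laplace (V i)))
      have : 0 ≤ ∑ j, pairL2 (partialD j (V i)) (partialD j (V i)) :=
        Finset.sum_nonneg fun _ _ => pairL2_self_nonneg _
      linarith
    have hνL := mul_nonneg hν (neg_nonneg.2 hL)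
    generalize V i - α ^ 2 • laplace (V i) = T at h1 hM hg hV hνL ⊢
    simp only [map_add, map_sub, map_neg, map_smul, LinearMap.add_apply, LinearMap.sub_apply,
      LinearMap.neg_apply, LinearMap.smul_apply, smul_eq_mul, hM, hg, hV] at h1
    linarith
  have hsum := Finset.sum_le_sum fun i (_ : i ∈ Finset.univ) => hcomp i
  rw [← Finset.mul_sum, Finset.sum_sub_distrib, Finset.sum_sub_distrib, hpressure, sub_zero] at hsum
  exact hsum

/-- Each term of the trilinear form `∫ (w · ∇) u · w` is controlled by the `H¹_α` norms. -/
theorem pairL2_trilinear_sq_le {α E : ℝ} (hα : 0 < α) {w₁ w₂ : 𝓢(V3, ℝ)} (u : 𝓢(V3, ℝ)) (j : Fin 3)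
    (h₁ : energy α w₁ ≤ E) (h₂ : energy α w₂ ≤ E) :
    α ^ 5 * pairL2 (schwartzMul w₁ (partialD j u)) w₂ ^ 2 ≤ 400 * E ^ 2 * energy α u := by
  have hcs := pairL2_sq_le (partialD j u) (schwartzMul w₁ w₂)
  rw [← pairL2_schwartzMul_left] at hcs
  have hmix : 2 * pairL2 (schwartzMul w₁ w₂) (schwartzMul w₁ w₂)
      ≤ pairL2 (schwartzMul w₁ w₁) (schwartzMul w₁ w₁)
        + pairL2 (schwartzMul w₂ w₂) (schwartzMul w₂ w₂) := by
    have h := pairL2_self_nonneg (schwartzMul w₁ w₁ - schwartzMul w₂ w₂)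
    have he : pairL2 (schwartzMul w₁ w₁) (schwartzMul w₂ w₂)
        = pairL2 (schwartzMul w₁ w₂) (schwartzMul w₁ w₂) := by
      simp only [pairL2_apply, schwartzMul_apply]
      congr 1; ext x; ring
    simp only [map_sub, LinearMap.sub_apply, pairL2_comm (schwartzMul w₂ w₂) (schwartzMul w₁ w₁),
      he] at h
    linarith
  have hw : α ^ 3 * pairL2 (schwartzMul w₁ w₂) (schwartzMul w₁ w₂) ≤ 400 * E ^ 2 := by
    have e₁ := (pairL2_sq_sq_le α w₁).trans
      (mul_le_mul_of_nonneg_left (pow_le_pow_left₀ (energy_nonneg α w₁) h₁ 2) (by norm_num))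
    have e₂ := (pairL2_sq_sq_le α w₂).trans
      (mul_le_mul_of_nonneg_left (pow_le_pow_left₀ (energy_nonneg α w₂) h₂ 2) (by norm_num))
    have := mul_le_mul_of_nonneg_left hmix (pow_pos hα 3).le
    linarith
  have hu : α ^ 2 * pairL2 (partialD j u) (partialD j u) ≤ energy α u := by
    have hj : pairL2 (partialD j u) (partialD j u)
        ≤ ∑ k, pairL2 (partialD k u) (partialD k u) :=
      Finset.single_le_sum (f := fun k => pairL2 (partialD k u) (partialD k u))
        (fun _ _ => pairL2_self_nonneg _) (Finset.mem_univ j)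
    have := mul_le_mul_of_nonneg_left hj (sq_nonneg α)
    have := pairL2_self_nonneg u
    rw [energy]
    linarith
  calc α ^ 5 * pairL2 (schwartzMul w₁ (partialD j u)) w₂ ^ 2
      ≤ α ^ 5 * (pairL2 (partialD j u) (partialD j u)
          * pairL2 (schwartzMul w₁ w₂) (schwartzMul w₁ w₂)) := by gcongr
    _ = α ^ 3 * pairL2 (schwartzMul w₁ w₂) (schwartzMul w₁ w₂)
          * (α ^ 2 * pairL2 (partialD j u) (partialD j u)) := by ring
    _ ≤ 400 * E ^ 2 * energy α u := by
        exact mul_le_mul hw hu (mul_nonneg (sq_nonneg α) (pairL2_self_nonneg _)) (by positivity)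

/-- Uniqueness for the stationary system in terms of Schwartz components. -/
theorem stationary_unique_of_components {α β ν : ℝ} (hα : 0 < α) (hβ : 0 < β) (hν : 0 < ν)
    {f U₁ U₂ N₁ N₂ : Fin 3 → 𝓢(V3, ℝ)} {P₁ P₂ : 𝓢(V3, ℝ)}
    (hsmall : 180 / (α ^ (5 / 2 : ℝ) * β) * √(∑ i, energy α (f i)) < β)
    (hdiv₁ : ∑ j, partialD j (U₁ j) = 0) (hdiv₂ : ∑ j, partialD j (U₂ j) = 0)
    (hfilter₁ : ∀ i, N₁ i - α ^ 2 • laplace (N₁ i) = convect U₁ U₁ i)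
    (hfilter₂ : ∀ i, N₂ i - α ^ 2 • laplace (N₂ i) = convect U₂ U₂ i)
    (hmom₁ : ∀ i, -(ν • laplace (U₁ i)) + N₁ i + partialD i P₁ = f i - β • U₁ i)
    (hmom₂ : ∀ i, -(ν • laplace (U₂ i)) + N₂ i + partialD i P₂ = f i - β • U₂ i) :
    U₁ = U₂ := by
  set F := ∑ i, energy α (f i) with hF
  have hU : β ^ 2 * ∑ i, energy α (U₁ i) ≤ F := by
    have h := energy_estimate hν.le hdiv₁ hfilter₁ hmom₁
    rw [sum_pairL2_convect_self hdiv₁, sub_zero] at h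
    have hY : 2 * β * ∑ i, energyForm α (f i) (U₁ i) ≤ F + β ^ 2 * ∑ i, energy α (U₁ i) := by
      rw [hF, Finset.mul_sum, Finset.mul_sum, ← Finset.sum_add_distrib]
      exact Finset.sum_le_sum fun i _ => two_mul_energyForm_le α β _ _
    have := mul_le_mul_of_nonneg_left h (by positivity : 0 ≤ 2 * β)
    linarith
  set W : Fin 3 → 𝓢(V3, ℝ) := fun i => U₁ i - U₂ i with hW
  set E := ∑ i, energy α (W i) with hE
  have hWE : ∀ i, energy α (W i) ≤ E := fun i =>
    Finset.single_le_sum (f := fun i => energy α (W i)) (fun _ _ => energy_nonneg α _)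
      (Finset.mem_univ i)
  have hUE : ∀ i, energy α (U₁ i) ≤ F / β ^ 2 := fun i => by
    rw [le_div_iff₀' (by positivity)]
    refine le_trans ?_ hU
    gcongr
    exact Finset.single_le_sum (f := fun i => energy α (U₁ i)) (fun _ _ => energy_nonneg α _)
      (Finset.mem_univ i)
  have hE0 : 0 ≤ E := Finset.sum_nonneg fun i _ => energy_nonneg α _
  have hF0 : 0 ≤ F := Finset.sum_nonneg fun i _ => energy_nonneg α _
  have hdiff : ∀ i, convect U₁ U₁ i - convect U₂ U₂ i = convect W U₁ i + convect U₂ W i := by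
    intro i
    simp only [convect, ← Finset.sum_sub_distrib, ← Finset.sum_add_distrib, hW]
    refine Finset.sum_congr rfl fun j _ => ?_
    ext x
    simp
    ring
  have hest : β * E ≤ - ∑ i, pairL2 (convect W U₁ i) (W i) := by
    have h := energy_estimate (α := α) (β := β) (V := W) (M := fun i => N₁ i - N₂ i)
      (g := fun _ => 0) (h := fun i => convect W U₁ i + convect U₂ W i) (Q := P₁ - P₂) hν.le
      (by simp only [hW, map_sub, Finset.sum_sub_distrib, hdiv₁, hdiv₂, sub_zero])
      (fun i => by
        rw [← hdiff, ← hfilter₁, ← hfilter₂, map_sub, smul_sub]; abel)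
      (fun i => by
        have h1 := congrArg₂ (· - ·) (hmom₁ i) (hmom₂ i)
        simp only [hW, map_sub, smul_sub] at h1 ⊢
        calc _ = _ := by abel
          _ = _ := h1
          _ = _ := by abel)
    simpa [energyForm, Finset.sum_add_distrib, sum_pairL2_convect_self hdiv₂] using h
  have hα5 : (α ^ (5 / 2 : ℝ)) ^ 2 = α ^ 5 := by
    rw [← Real.rpow_mul_natCast hα.le, ← Real.rpow_natCast]; norm_num
  have hterm : ∀ i j, |pairL2 (schwartzMul (W j) (partialD j (U₁ i))) (W i)|
      ≤ 20 / (α ^ (5 / 2 : ℝ) * β) * √F * E := by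
    intro i j
    refine abs_le_of_sq_le_sq ?_ (by positivity)
    have h := pairL2_trilinear_sq_le hα (U₁ i) j (hWE j) (hWE i)
    have h2 : 400 * E ^ 2 * energy α (U₁ i) ≤ 400 * E ^ 2 * (F / β ^ 2) := by
      gcongr
      exact hUE i
    rw [mul_pow, mul_pow, div_pow, mul_pow, Real.sq_sqrt hF0, hα5]
    rw [← mul_le_mul_iff_right₀ (pow_pos hα 5)]
    refine (h.trans h2).trans (le_of_eq ?_)
    field_simp
    ring
  have hbound : - ∑ i, pairL2 (convect W U₁ i) (W i) ≤ 180 / (α ^ (5 / 2 : ℝ) * β) * √F * E := by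
    refine (neg_le_abs _).trans ((Finset.abs_sum_le_sum_abs _ _).trans ?_)
    calc ∑ i, |pairL2 (convect W U₁ i) (W i)|
        ≤ ∑ _i : Fin 3, ∑ _j : Fin 3, 20 / (α ^ (5 / 2 : ℝ) * β) * √F * E := by
          refine Finset.sum_le_sum fun i _ => ?_
          rw [convect, map_sum, LinearMap.sum_apply]
          exact (Finset.abs_sum_le_sum_abs _ _).trans (Finset.sum_le_sum fun j _ => hterm i j)
      _ = _ := by simp; ring
  have hE_zero : E = 0 := by
    by_contra hne
    have hpos : 0 < E := lt_of_le_of_ne hE0 (Ne.symm hne)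
    have := mul_lt_mul_of_pos_right hsmall hpos
    linarith
  funext i
  have hi : energy α (W i) ≤ 0 := hE_zero ▸ hWE i
  have hWi : pairL2 (W i) (W i) = 0 := by
    refine le_antisymm (le_trans ?_ hi) (pairL2_self_nonneg _)
    exact le_add_of_nonneg_right (mul_nonneg (sq_nonneg α)
      (Finset.sum_nonneg fun _ _ => pairL2_self_nonneg _))
  exact sub_eq_zero.1 (eq_zero_of_pairL2_self hWi)

end EnergyEstimates

section Components

/-- Bundle a function satisfying `IsSchwartz` as a Schwartz map. -/
def IsSchwartz.toSchwartz {F : Type*} [NormedAddCommGroup F] [NormedSpace ℝ F] {g : V3 → F}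
    (hg : IsSchwartz g) : 𝓢(V3, F) := ⟨g, hg.1, hg.2⟩

/-- The `i`-th component of a vector-valued Schwartz function. -/
def component (i : Fin 3) (G : 𝓢(V3, Fin 3 → ℝ)) : 𝓢(V3, ℝ) :=
  SchwartzMap.postcompCLM (ContinuousLinearMap.proj (R := ℝ) (φ := fun _ : Fin 3 => ℝ) i) G

theorem component_apply (i : Fin 3) (G : 𝓢(V3, Fin 3 → ℝ)) (x : V3) : component i G x = G x i := rfl

theorem pd_apply_eq (j i : Fin 3) (G : 𝓢(V3, Fin 3 → ℝ)) (x : V3) :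
    pd j G x i = partialD j (component i G) x := by
  rw [partialD_apply]
  change fderiv ℝ G x _ i = fderiv ℝ (fun y => G y i) x _
  rw [fderiv_apply G.differentiableAt]
  rfl

theorem pd_pd_apply_eq (j k i : Fin 3) (G : 𝓢(V3, Fin 3 → ℝ)) (x : V3) :
    pd j (pd k G) x i = partialD j (partialD k (component i G)) x := by
  have h : component i (∂_{(Pi.single k (1 : ℝ) : V3)} G) = partialD k (component i G) := by
    ext y
    exact pd_apply_eq k i G y
  rw [← h, ← pd_apply_eq]
  rfl

theorem H1aSq_eq_sum_energy (α : ℝ) (G : 𝓢(V3, Fin 3 → ℝ)) :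
    H1aSq α G = ∑ i, energy α (component i G) := by
  have hL : L2sq G = ∑ i, pairL2 (component i G) (component i G) := by
    simp only [L2sq, sq, pairL2_apply]
    exact integral_finsetSum _ fun i _ => (schwartzMul (component i G) (component i G)).integrable
  have hH : H1sq G = ∑ i, ∑ j, pairL2 (partialD j (component i G)) (partialD j (component i G)) := by
    simp only [H1sq, sq, pairL2_apply, pd_apply_eq]
    have hi : ∀ i j, Integrable fun x =>
        partialD j (component i G) x * partialD j (component i G) x := fun i j =>
      (schwartzMul (partialD j (component i G)) (partialD j (component i G))).integrable
    rw [integral_finsetSum _ fun i _ => integrable_finsetSum _ fun j _ => hi i j]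
    exact Finset.sum_congr rfl fun i _ => integral_finsetSum _ fun j _ => hi i j
  simp only [H1aSq, hL, hH, energy, Finset.sum_add_distrib, Finset.mul_sum]

theorem sum_apply_schwartz (s : Fin 3 → 𝓢(V3, ℝ)) (x : V3) : (∑ j, s j) x = ∑ j, s j x := by
  simp

namespace StationarySolution

variable {α β ν : ℝ} {f : V3 → Fin 3 → ℝ}

theorem sum_partialD_component (S : StationarySolution α β ν f) :
    ∑ j, partialD j (component j S.schwartz_U.toSchwartz) = 0 := by
  ext x
  rw [sum_apply_schwartz]
  simp only [← pd_apply_eq]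
  exact S.divFree x

theorem helmholtz_component (S : StationarySolution α β ν f) (i : Fin 3) :
    component i S.schwartz_N.toSchwartz - α ^ 2 • laplace (component i S.schwartz_N.toSchwartz)
      = convect (fun j => component j S.schwartz_U.toSchwartz)
          (fun j => component j S.schwartz_U.toSchwartz) i := by
  ext x
  have h := S.filter x i
  rw [laplace_apply, convect, sum_apply_schwartz, sub_apply, smul_apply,
    sum_apply_schwartz]
  simp only [schwartzMul_apply, ← pd_apply_eq, ← pd_pd_apply_eq, component_apply, smul_eq_mul]
  refine Eq.trans ?_ h
  change S.N x i - α ^ 2 * (∑ j, pd j (pd j S.N) x i) = _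
  ring

theorem momentum_component (S : StationarySolution α β ν f) (hf : IsSchwartz f) (i : Fin 3) :
    -(ν • laplace (component i S.schwartz_U.toSchwartz)) + component i S.schwartz_N.toSchwartz
        + partialD i S.schwartz_P.toSchwartz
      = component i hf.toSchwartz - β • component i S.schwartz_U.toSchwartz := by
  ext x
  have h := S.momentum x i
  rw [laplace_apply, add_apply, add_apply, neg_apply,
    smul_apply, sub_apply, smul_apply, sum_apply_schwartz]
  simp only [← pd_pd_apply_eq, component_apply, smul_eq_mul]
  refine Eq.trans ?_ h
  change -(ν * (∑ j, pd j (pd j S.U) x i)) + S.N x i + pdS i S.P x = _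
  ring

end StationarySolution

end Components

/-- Uniqueness of the stationary solution when the damping parameter dominates the force. -/
theorem stationary_uniqueness :
    ∃ c : ℝ, 0 < c ∧
    ∀ (α β ν : ℝ), 0 < α → 0 < β → 0 < ν →
    ∀ (f : V3 → Fin 3 → ℝ), IsForce f →
      c / (α ^ ((5:ℝ)/2) * β) * Real.sqrt (H1aSq α f) < β →
    ∀ (S₁ S₂ : StationarySolution α β ν f), S₁.U = S₂.U := by
  refine ⟨180, by norm_num, fun α β ν hα hβ hν f hf hsmall S₁ S₂ => ?_⟩
  have hF : H1aSq α f = ∑ i, energy α (component i hf.1.toSchwartz) :=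
    H1aSq_eq_sum_energy α hf.1.toSchwartz
  rw [hF] at hsmall
  have h := stationary_unique_of_components hα hβ hν hsmall
    S₁.sum_partialD_component S₂.sum_partialD_component
    S₁.helmholtz_component S₂.helmholtz_component
    (S₁.momentum_component hf.1) (S₂.momentum_component hf.1)
  funext x i
  exact congrArg (fun V : Fin 3 → 𝓢(V3, ℝ) => V i x) h

end
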